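/- Let γ be a C¹, strictly convex, increasing function on (0,a₀] with 0 < γ'(ξ) < 1 for all ξ ∈ (0,a₀), γ'(a₀) = 1, and lim_{ξ→0⁺} γ(ξ) = 0. Let a_j := (γ')^{−1}(2^{−j}) for j ≥ 0 (so a_0 = a₀ and (a_j) is a strictly decreasing sequence of positive numbers), and set b_j := γ(a_j). Assume that the sequence (a_j)_{j≥0} is concave, i.e. a_{j−1} − a_j ≥ a_j − a_{j+1} for all j ≥ 1. Then for every j ≥ 0 one has b_j ≤ 2(a_j − a_{j+1}). -/

import Mathlib

open MeasureTheory Set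
open scoped ENNReal NNReal

noncomputable section

/-- The character `e^{2π i t x}`. -/
def eChar (t x : ℝ) : ℂ := Complex.exp (2 * Real.pi * Complex.I * t * x)

/-- The Fourier transform `f̂(ξ) = ∫ f(x) e^{-2π i ξ x} dx`. -/
def fourierT (f : ℝ → ℂ) (ξ : ℝ) : ℂ := ∫ x : ℝ, f x * eChar (-ξ) x

/-- The bilinear multiplier operator `B_m` with symbol `m`. -/
def Bm (m : ℝ → ℝ → ℂ) (f g : ℝ → ℂ) (x : ℝ) : ℂ :=
  ∫ ξ : ℝ, ∫ η : ℝ, m ξ η * fourierT f ξ * fourierT g η * eChar (ξ + η) x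

/-- Complex-valued indicator function of a set of reals. -/
def indC (s : Set ℝ) (x : ℝ) : ℂ := s.indicator 1 x

/-- The set `-A - B = {-x-y : x ∈ A, y ∈ B}`. -/
def mink2 (A B : Set ℝ) : Set ℝ := Set.image2 (fun x y => -x - y) A B

/-- The paraproduct symbol `m_{a,b}(ξ,η) = Σ_{j≥1} 1_{[a_{j+1},a_j)}(ξ) 1_{[b_j,b_0)}(η)`. -/
def mab (a b : ℕ → ℝ) (ξ η : ℝ) : ℂ :=
  ∑' j : ℕ, indC (Ico (a (j + 2)) (a (j + 1))) ξ * indC (Ico (b (j + 1)) (b 0)) η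

/-- The interval `-[a_{j+1},a_j) - [b_j, b_0)` from the collection `I_{a,b}`. -/
def Iab (a b : ℕ → ℝ) (j : ℕ) : Set ℝ := mink2 (Ico (a (j + 1)) (a j)) (Ico (b j) (b 0))

/-- The interval `-[a_{j+1},a_j) - (b_∞, b_j)` from the collection `J_{a,b}`. -/
def Jab (a b : ℕ → ℝ) (binf : ℝ) (j : ℕ) : Set ℝ :=
  mink2 (Ico (a (j + 1)) (a j)) (Ioo binf (b j))

/-- The symbol `m̃_{u,v}(ξ,η) = Σ_{j≥1} 1_{(u_0,u_j]}(ξ) 1_{[v_j,v_{j+1})}(η)`. -/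
def muv (u v : ℕ → ℝ) (ξ η : ℝ) : ℂ :=
  ∑' j : ℕ, indC (Ioc (u 0) (u (j + 1))) ξ * indC (Ico (v (j + 1)) (v (j + 2))) η

/-- The interval `-(u_0,u_j] - [v_j, v_{j+1})`. -/
def Iuv (u v : ℕ → ℝ) (j : ℕ) : Set ℝ :=
  mink2 (Ioc (u 0) (u j)) (Ico (v j) (v (j + 1)))

/-- The frequency projection `(1_S f̂)^∨`. -/
def fproj (S : Set ℝ) (f : ℝ → ℂ) (x : ℝ) : ℂ := ∫ ξ in S, fourierT f ξ * eChar ξ x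

/-- The `L^p(ℓ²)` norm of the family of frequency projections onto the sets `T i`. -/
def sqNormLp {ι : Type*} (T : ι → Set ℝ) (f : ℝ → ℂ) (p : ℝ) : ℝ≥0∞ :=
  (∫⁻ x : ℝ, (∑' i, ((‖fproj (T i) f x‖₊ : ℝ≥0∞)) ^ 2) ^ (p / 2)) ^ (1 / p)

/-- The collection of connected components of a set `U ⊆ ℝ`. -/
def componentsOf (U : Set ℝ) : Set (Set ℝ) := {S | ∃ x ∈ U, S = connectedComponentIn U x}

/-- A closed Lebesgue-null set `E ⊆ ℝ` is Littlewood–Paley if for every `1 < p < ∞` the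
square function associated with the connected components of `ℝ \ E` is comparable with the
`L^p` norm (stated on the dense class of Schwartz functions). -/
def IsLPSet (E : Set ℝ) : Prop :=
  IsClosed E ∧ volume E = 0 ∧
    ∀ p : ℝ, 1 < p → ∃ c : ℝ, 0 < c ∧ ∃ C : ℝ, 0 < C ∧
      ∀ f : SchwartzMap ℝ ℂ,
        ENNReal.ofReal c * eLpNorm (⇑f) (ENNReal.ofReal p) volume ≤
            sqNormLp (fun ω : componentsOf Eᶜ => (ω : Set ℝ)) (⇑f) p ∧
          sqNormLp (fun ω : componentsOf Eᶜ => (ω : Set ℝ)) (⇑f) p ≤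
            ENNReal.ofReal C * eLpNorm (⇑f) (ENNReal.ofReal p) volume

/-- A strictly monotone real sequence is Littlewood–Paley if the closure of its range is a
Littlewood–Paley set. -/
def IsLPSeq (a : ℕ → ℝ) : Prop := IsLPSet (closure (Set.range a))

/-- A family of (pairwise disjoint) intervals is Littlewood–Paley if for every `1 < p < ∞`
the associated square function is bounded by the `L^p` norm. -/
def IsLPFamily {ι : Type*} (T : ι → Set ℝ) : Prop :=
  ∀ p : ℝ, 1 < p → ∃ C : ℝ, 0 < C ∧ ∀ f : SchwartzMap ℝ ℂ,
    sqNormLp T (⇑f) p ≤ ENNReal.ofReal C * eLpNorm (⇑f) (ENNReal.ofReal p) volume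

/-- Slope of the `j`-th segment of the piecewise linear curve with vertices `(a_j, b_j)`. -/
def pslope (a b : ℕ → ℝ) (j : ℕ) : ℝ := (b j - b (j + 1)) / (a j - a (j + 1))

/-- The epigraph of the piecewise linear curve with vertices `(a_j, b_j)`. -/
def polyEpi (a b : ℕ → ℝ) : Set (ℝ × ℝ) :=
  ⋃ j : ℕ, {p : ℝ × ℝ | a (j + 1) ≤ p.1 ∧ p.1 ≤ a j ∧
    b (j + 1) + pslope a b j * (p.1 - a (j + 1)) ≤ p.2}

end

/-- Complex-valued indicator function of a set in the plane, as a bilinear symbol. -/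
noncomputable def indC2 (S : Set (ℝ × ℝ)) (ξ η : ℝ) : ℂ := S.indicator 1 (ξ, η)

/-- A convex function lies above its tangent lines. -/
theorem ConvexOn.tangent_le_of_hasDerivWithinAt {s : Set ℝ} {f : ℝ → ℝ} {f' x y : ℝ}
    (hf : ConvexOn ℝ s f) (hx : x ∈ s) (hy : y ∈ s) (hd : HasDerivWithinAt f f' s y) :
    f y + f' * (x - y) ≤ f x := by
  rcases lt_trichotomy x y with h | rfl | h
  · have := hf.slope_le_of_hasDerivWithinAt hx hy h hd
    rw [slope_def_field, div_le_iff₀ (sub_pos.2 h)] at this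
    linarith
  · simp
  · have := hf.le_slope_of_hasDerivWithinAt hy hx h hd
    rw [slope_def_field, le_div_iff₀ (sub_pos.2 h)] at this
    linarith

/-- Key estimate for concave sequences: if `γ` is `C¹`, strictly convex and increasing on
`(0,a₀]` with `0 < γ' < 1` on `(0,a₀)`, `γ'(a₀) = 1`, `γ(0⁺) = 0`, `a_j = (γ')⁻¹(2^{-j})`,
`b_j = γ(a_j)`, and `(a_j)` is concave, then `b_j ≤ 2(a_j - a_{j+1})` for all `j ≥ 0`. -/
theorem concave_sequence_key_estimate (a0 : ℝ) (ha0 : 0 < a0) (G gd : ℝ → ℝ)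
    (hderiv : ∀ ξ ∈ Ioc (0 : ℝ) a0, HasDerivWithinAt G (gd ξ) (Ioc 0 a0) ξ)
    (hgdcont : ContinuousOn gd (Ioc 0 a0))
    (hconv : StrictConvexOn ℝ (Ioc 0 a0) G)
    (hmono : StrictMonoOn G (Ioc 0 a0))
    (hd : ∀ ξ ∈ Ioo (0 : ℝ) a0, 0 < gd ξ ∧ gd ξ < 1)
    (hda0 : gd a0 = 1)
    (hG0 : Filter.Tendsto G (nhdsWithin 0 (Ioi 0)) (nhds 0))
    (a : ℕ → ℝ) (hmem : ∀ j, a j ∈ Ioc (0 : ℝ) a0)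
    (hainv : ∀ j : ℕ, gd (a j) = ((2 : ℝ) ^ j)⁻¹)
    (haconc : ∀ j : ℕ, a (j + 1) - a (j + 2) ≤ a j - a (j + 1)) :
    ∀ j : ℕ, G (a j) ≤ 2 * (a j - a (j + 1)) := by
  have tangent : ∀ k, ∀ x ∈ Ioc (0 : ℝ) a0, G (a k) + ((2 : ℝ) ^ k)⁻¹ * (x - a k) ≤ G x :=
    fun k x hx => by
      have := hderiv (a k) (hmem k)
      rw [hainv] at this
      exact hconv.convexOn.tangent_le_of_hasDerivWithinAt hx (hmem k) this
  have halve : ∀ k : ℕ, ((2 : ℝ) ^ (k + 1))⁻¹ = ((2 : ℝ) ^ k)⁻¹ / 2 := fun k => by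
    rw [pow_succ, mul_inv, div_eq_mul_inv]
  have anti : Antitone fun k => a k - a (k + 1) := antitone_nat_of_succ_le haconc
  have diff_nonneg : ∀ k, 0 ≤ a k - a (k + 1) := fun k => by
    have h₁ := tangent k _ (hmem (k + 1))
    have h₂ := tangent (k + 1) _ (hmem k)
    rw [halve] at h₂
    have hpos : (0 : ℝ) < ((2 : ℝ) ^ k)⁻¹ := by positivity
    by_contra! hneg
    nlinarith
  have le_end : ∀ k, G (a k) ≤ ((2 : ℝ) ^ k)⁻¹ * a0 := fun k => by
    have hlim : Filter.Tendsto (fun x : ℝ => G (a k) + ((2 : ℝ) ^ k)⁻¹ * (x - a k))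
        (nhdsWithin 0 (Ioi 0)) (nhds (G (a k) + ((2 : ℝ) ^ k)⁻¹ * (0 - a k))) :=
      (Continuous.tendsto (by fun_prop) 0).mono_left nhdsWithin_le_nhds
    have hle := le_of_tendsto_of_tendsto hlim hG0
      (Filter.mem_of_superset (Ioc_mem_nhdsGT ha0) (tangent k))
    have := mul_le_mul_of_nonneg_left (hmem k).2 (by positivity : 0 ≤ ((2 : ℝ) ^ k)⁻¹)
    linarith
  intro j
  have telescope : ∀ n, G (a j) ≤ G (a (j + n)) +
      2 * (((2 : ℝ) ^ j)⁻¹ - ((2 : ℝ) ^ (j + n))⁻¹) * (a j - a (j + 1)) := fun n => by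
    induction n with
    | zero => simp
    | succ n ih =>
      have h₁ := tangent (j + n) _ (hmem (j + n + 1))
      have h₂ := mul_le_mul_of_nonneg_left (anti (Nat.le_add_right j n))
        (by positivity : 0 ≤ ((2 : ℝ) ^ (j + n))⁻¹)
      rw [← add_assoc, halve]
      dsimp only at h₂
      linarith
  have bound : ∀ n, G (a j) ≤ ((2 : ℝ) ^ (n + j))⁻¹ * a0 + 2 * (a j - a (j + 1)) := fun n => by
    have h₁ := telescope n
    have h₂ := le_end (j + n)
    have h₃ : ((2 : ℝ) ^ j)⁻¹ ≤ 1 := inv_le_one_of_one_le₀ (one_le_pow₀ one_le_two)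
    have h₄ : (0 : ℝ) ≤ ((2 : ℝ) ^ (j + n))⁻¹ := by positivity
    rw [add_comm n j]
    nlinarith [diff_nonneg j]
  have hlim : Filter.Tendsto (fun k : ℕ => ((2 : ℝ) ^ k)⁻¹) Filter.atTop (nhds 0) :=
    tendsto_inv_atTop_zero.comp (tendsto_pow_atTop_atTop_of_one_lt one_lt_two)
  have hlim' := (((Filter.tendsto_add_atTop_iff_nat j).2 hlim).mul_const a0).add_const
    (2 * (a j - a (j + 1)))
  rw [zero_mul, zero_add] at hlim'
  exact ge_of_tendsto' hlim' bound
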